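/- On the open unit disk B₁ ⊂ ℝ², the function u(x) = log(log(e/|x|)) satisfies: the distributional Laplacian Δu equals −1/(|x|² log²(e/|x|)), which belongs to L¹(B₁), while the distributional Hessian D²u is NOT in L¹(B₁) (its entries are not integrable functions near the origin; indeed |D²u| behaves like 1/(|x|² log(e/|x|)) which is non-integrable). -/

import Mathlib

open MeasureTheory Metric Filter

namespace LogLog
open Topology Set

abbrev E2 := EuclideanSpace ℝ (Fin 2)

/-- punctured disc -/
def U : Set E2 := ball 0 1 \ {0}

noncomputable def e (i : Fin 2) : E2 := EuclideanSpace.single i 1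

noncomputable def L (x : E2) : ℝ := Real.log (Real.exp 1 / ‖x‖)

noncomputable def D (i : Fin 2) (G : E2 → ℝ) (x : E2) : ℝ := fderiv ℝ G x (e i)

lemma isOpen_U : IsOpen U := isOpen_ball.sdiff isClosed_singleton

lemma U_ae : (U : Set E2) =ᵐ[volume] ball (0 : E2) 1 := by
  unfold U
  exact sdiff_null_ae_eq_self (measure_singleton _)

lemma restrict_U : (volume : Measure E2).restrict (ball 0 1) = volume.restrict U :=
  (Measure.restrict_congr_set U_ae).symm

lemma U_ne {x : E2} (hx : x ∈ U) : x ≠ 0 := fun h => hx.2 h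

lemma U_pos {x : E2} (hx : x ∈ U) : 0 < ‖x‖ := norm_pos_iff.2 (U_ne hx)

lemma U_lt {x : E2} (hx : x ∈ U) : ‖x‖ < 1 := by simpa using hx.1

lemma log_exp_div {r : ℝ} (hr : 0 < r) : Real.log (Real.exp 1 / r) = 1 - Real.log r := by
  rw [Real.log_div (Real.exp_pos 1).ne' hr.ne', Real.log_exp]

lemma L_eq {x : E2} (hx : x ≠ 0) : L x = 1 - Real.log (‖x‖ ^ 2) / 2 := by
  unfold L
  rw [log_exp_div (norm_pos_iff.2 hx), Real.log_pow]
  push_cast; ring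

lemma one_lt_L {x : E2} (hx : x ∈ U) : 1 < L x := by
  unfold L
  rw [log_exp_div (U_pos hx)]
  linarith [Real.log_neg (U_pos hx) (U_lt hx)]

lemma hasFDerivAt_L {x : E2} (hx : x ≠ 0) :
    HasFDerivAt L (-(‖x‖ ^ 2)⁻¹ • innerSL ℝ x) x := by
  have h1 : HasFDerivAt (fun y : E2 => ‖y‖ ^ 2) (2 • innerSL ℝ x) x :=
    (hasStrictFDerivAt_norm_sq x).hasFDerivAt
  have hn : ‖x‖ ^ 2 ≠ 0 := pow_ne_zero 2 (norm_ne_zero_iff.2 hx)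
  have h2 := ((h1.log hn).const_mul (1/2 : ℝ)).const_sub 1
  have h3 : L =ᶠ[𝓝 x] fun y => 1 - 1/2 * Real.log (‖y‖ ^ 2) := by
    filter_upwards [isOpen_ne.mem_nhds hx] with y hy
    rw [L_eq hy]; ring
  refine (h2.congr_of_eventuallyEq h3).congr_fderiv ?_
  ext v
  simp
  ring

lemma contDiffAt_L {x : E2} (hx : x ≠ 0) {n : WithTop ℕ∞} : ContDiffAt ℝ n L x := by
  unfold L
  have h := contDiffAt_norm (n := n) ℝ hx
  have h0 : ‖x‖ ≠ 0 := norm_ne_zero_iff.2 hx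
  exact (contDiffAt_const.div h h0).log (div_ne_zero (Real.exp_pos 1).ne' h0)

lemma inner_e (x : E2) (i : Fin 2) : inner ℝ x (e i) = x i := by
  simp [e, EuclideanSpace.inner_single_right]

lemma D_L {x : E2} (hx : x ≠ 0) (i : Fin 2) : D i L x = -(‖x‖ ^ 2)⁻¹ * x i := by
  simp [D, (hasFDerivAt_L hx).fderiv, inner_e]

noncomputable def u (x : E2) : ℝ := Real.log (L x)

/-- the gradient of `u` -/
noncomputable def G (i : Fin 2) (x : E2) : ℝ := -(x i * (‖x‖ ^ 2)⁻¹ * (L x)⁻¹)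

noncomputable def K (j i : Fin 2) (x : E2) : ℝ :=
  (if j = i then -((‖x‖ ^ 2)⁻¹ * (L x)⁻¹) else 0) +
    x i * x j * ((‖x‖ ^ 2)⁻¹) ^ 2 * (2 * (L x)⁻¹ - ((L x)⁻¹) ^ 2)

lemma contDiffOn_u {n : WithTop ℕ∞} : ContDiffOn ℝ n u U := fun x hx =>
  ((contDiffAt_L (U_ne hx)).log (by linarith [one_lt_L hx])).contDiffWithinAt

lemma D_u {x : E2} (hx : x ∈ U) (i : Fin 2) : D i u x = G i x := by
  have h := (hasFDerivAt_L (U_ne hx)).log (by linarith [one_lt_L hx])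
  have : fderiv ℝ u x = _ := h.fderiv
  rw [D, this]
  simp [inner_e, G]
  ring

lemma contDiff_coord {n : WithTop ℕ∞} (i : Fin 2) : ContDiff ℝ n (fun x : E2 => x i) :=
  (EuclideanSpace.proj i : E2 →L[ℝ] ℝ).contDiff

lemma contDiffOn_G {n : WithTop ℕ∞} (i : Fin 2) : ContDiffOn ℝ n (G i) U := fun x hx => by
  have h0 : ‖x‖ ^ 2 ≠ 0 := pow_ne_zero 2 (U_pos hx).ne'
  refine ContDiffAt.contDiffWithinAt (ContDiffAt.neg ?_)
  exact (((contDiff_coord i).contDiffAt).mul ((contDiffAt_id.norm_sq ℝ).inv h0)).mul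
    ((contDiffAt_L (U_ne hx)).inv (by linarith [one_lt_L hx]))

lemma D_G {x : E2} (hx : x ∈ U) (j i : Fin 2) : D j (G i) x = K j i x := by
  have h0 : ‖x‖ ^ 2 ≠ 0 := pow_ne_zero 2 (U_pos hx).ne'
  have hL : L x ≠ 0 := by linarith [one_lt_L hx]
  have h1 : HasFDerivAt (fun y : E2 => ‖y‖ ^ 2) (2 • innerSL ℝ x) x :=
    (hasStrictFDerivAt_norm_sq x).hasFDerivAt
  have h2 := (hasDerivAt_inv h0).comp_hasFDerivAt x h1
  have h3 := (hasDerivAt_inv hL).comp_hasFDerivAt x (hasFDerivAt_L (U_ne hx))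
  have h4 : HasFDerivAt (fun y : E2 => y i) (EuclideanSpace.proj i : E2 →L[ℝ] ℝ) x :=
    (EuclideanSpace.proj i : E2 →L[ℝ] ℝ).hasFDerivAt
  have h := ((h4.mul h2).mul h3).neg
  have : fderiv ℝ (G i) x = _ := h.fderiv
  rw [D, this]
  have he : (e j) i = if j = i then 1 else 0 := by
    simp [e, eq_comm]
  simp [inner_e, K, he]
  split_ifs <;> ring

lemma norm_sq_eq (x : E2) : ‖x‖ ^ 2 = x 0 ^ 2 + x 1 ^ 2 := by
  simp [EuclideanSpace.norm_sq_eq]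

lemma sum_K {x : E2} (hx : x ∈ U) : ∑ i, K i i x = -(‖x‖ ^ 2 * L x ^ 2)⁻¹ := by
  have h0 : ‖x‖ ^ 2 ≠ 0 := pow_ne_zero 2 (U_pos hx).ne'
  have hL : L x ≠ 0 := by linarith [one_lt_L hx]
  simp only [K, Fin.sum_univ_two, if_true]
  have : x 0 ^ 2 = ‖x‖ ^ 2 - x 1 ^ 2 := by rw [norm_sq_eq]; ring
  generalize ‖x‖ ^ 2 = n at *
  field_simp
  rw [this]; ring

lemma contOn_K (j i : Fin 2) : ContinuousOn (K j i) U := by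
  have : ContinuousOn (D j (G i)) U := by
    have := (contDiffOn_G (n := 1) i).continuousOn_fderiv_of_isOpen isOpen_U le_rfl
    exact this.clm_apply continuousOn_const
  exact this.congr fun x hx => (D_G hx j i).symm

lemma abs_coord_le (x : E2) (i : Fin 2) : |x i| ≤ ‖x‖ := by
  simpa using PiLp.norm_apply_le x i

lemma abs_G_le {x : E2} (hx : x ∈ U) (i : Fin 2) : |G i x| ≤ ‖x‖⁻¹ * (L x)⁻¹ := by
  have hr := U_pos hx
  have hL : 0 < L x := by linarith [one_lt_L hx]
  rw [G, abs_neg, abs_mul, abs_mul, abs_of_pos (inv_pos.2 hL), abs_of_pos (by positivity : 0 < (‖x‖ ^ 2)⁻¹)]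
  gcongr
  calc |x i| * (‖x‖ ^ 2)⁻¹ ≤ ‖x‖ * (‖x‖ ^ 2)⁻¹ := by gcongr; exact abs_coord_le x i
    _ = ‖x‖⁻¹ := by field_simp

lemma abs_u_le_L {x : E2} (hx : x ∈ U) : |u x| ≤ L x := by
  have h := one_lt_L hx
  rw [u, abs_of_nonneg (Real.log_nonneg h.le)]
  linarith [Real.log_le_sub_one_of_pos (by linarith : 0 < L x)]

lemma abs_u_le {x : E2} (hx : x ∈ U) : |u x| ≤ ‖x‖⁻¹ := by
  have h := one_lt_L hx
  have hr := U_pos hx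
  rw [u, abs_of_nonneg (Real.log_nonneg h.le)]
  have h1 := Real.log_le_sub_one_of_pos (by linarith : 0 < L x)
  have h2 : L x = 1 + Real.log (‖x‖⁻¹) := by rw [L, log_exp_div hr, Real.log_inv]; ring
  have h3 := Real.log_le_sub_one_of_pos (inv_pos.2 hr)
  linarith

/-! ### integrability -/

lemma int_inv : IntegrableOn (fun x : E2 => ‖x‖⁻¹) (ball 0 1) volume := by
  rw [integrableOn_fun_norm_addHaar volume (f := fun r : ℝ => r⁻¹)]
  refine (integrableOn_const (C := (1:ℝ)) (by simp)).congr_fun (fun r hr => ?_) measurableSet_Ioo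
  have : r ≠ 0 := hr.1.ne'
  simp [this]

lemma tendsto_L0 : Tendsto (fun r : ℝ => Real.log (Real.exp 1 / r)) (𝓝[>] 0) atTop := by
  refine Real.tendsto_log_atTop.comp ?_
  exact (tendsto_inv_nhdsGT_zero.const_mul_atTop (Real.exp_pos 1)).congr
    fun r => (div_eq_mul_inv _ _).symm

lemma hasDeriv_L1 {r : ℝ} (hr : 0 < r) :
    HasDerivAt (fun r : ℝ => Real.log (Real.exp 1 / r)) (-r⁻¹) r := by
  have h := (Real.hasDerivAt_log hr.ne').const_sub 1
  refine h.congr_of_eventuallyEq ?_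
  filter_upwards [lt_mem_nhds hr] with s hs using log_exp_div hs

lemma L1_pos {r : ℝ} (hr : 0 < r) (h1 : r ≤ 1) : 1 ≤ Real.log (Real.exp 1 / r) := by
  rw [log_exp_div hr]
  linarith [Real.log_nonpos hr.le h1]

lemma int_sq : IntegrableOn (fun x : E2 => (‖x‖ ^ 2 * L x ^ 2)⁻¹) (ball 0 1) volume := by
  unfold L
  rw [integrableOn_fun_norm_addHaar volume
    (f := fun r : ℝ => (r ^ 2 * (Real.log (Real.exp 1 / r)) ^ 2)⁻¹)]
  have key : IntegrableOn (fun r : ℝ => r⁻¹ * ((Real.log (Real.exp 1 / r)) ^ 2)⁻¹) (Ioc 0 1) := by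
    refine intervalIntegral.integrableOn_deriv_of_nonneg
      (g := fun r => (Real.log (Real.exp 1 / r))⁻¹) ?_ ?_ ?_
    · intro r hr
      rcases hr.1.eq_or_lt with h | h
      · subst h
        have : Tendsto (fun r : ℝ => (Real.log (Real.exp 1 / r))⁻¹) (𝓝[>] 0) (𝓝 0) :=
          tendsto_L0.inv_tendsto_atTop
        have h2 : ContinuousWithinAt (fun r : ℝ => (Real.log (Real.exp 1 / r))⁻¹) (Ioi 0) 0 := by
          simpa [ContinuousWithinAt] using this
        exact (continuousWithinAt_insert_self.2 h2).mono (fun y hy => by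
          rcases hy.1.eq_or_lt with h | h
          · left; exact h.symm
          · right; exact h)
      · exact ((hasDeriv_L1 h).continuousAt.inv₀ (by linarith [L1_pos h hr.2])).continuousWithinAt
    · intro r hr
      have := (hasDeriv_L1 hr.1).inv (by linarith [L1_pos hr.1 hr.2.le])
      refine this.congr_deriv ?_
      rw [neg_neg, div_eq_mul_inv]
    · intro r hr
      have := hr.1
      positivity
  refine (key.mono_set Ioo_subset_Ioc_self).congr_fun (fun r hr => ?_) measurableSet_Ioo
  have : r ≠ 0 := hr.1.ne'
  simp
  field_simp

lemma not_int : ¬ IntegrableOn (fun x : E2 => (‖x‖ ^ 2)⁻¹ * (L x)⁻¹) (ball 0 1) volume := by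
  unfold L
  rw [integrableOn_fun_norm_addHaar volume
    (f := fun r : ℝ => (r ^ 2)⁻¹ * (Real.log (Real.exp 1 / r))⁻¹)]
  have hmem : Ioo (0:ℝ) 1 ∈ 𝓝[>] (0:ℝ) := Ioo_mem_nhdsGT one_pos
  have hd : ∀ r ∈ Ioo (0:ℝ) 1, HasDerivAt (fun r => Real.log (Real.log (Real.exp 1 / r)))
      (-r⁻¹ / Real.log (Real.exp 1 / r)) r := fun r hr =>
    (hasDeriv_L1 hr.1).log (by linarith [L1_pos hr.1 hr.2.le])
  refine not_integrableOn_of_tendsto_norm_atTop_of_deriv_isBigO_filter (𝓝[>] (0:ℝ))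
    (f := fun r => Real.log (Real.log (Real.exp 1 / r))) hmem ?_ ?_ ?_
  · filter_upwards [hmem] with r hr using (hd r hr).differentiableAt
  · exact tendsto_norm_atTop_atTop.comp (Real.tendsto_log_atTop.comp tendsto_L0)
  · refine Asymptotics.IsBigO.of_bound 1 ?_
    filter_upwards [hmem] with r hr
    rw [(hd r hr).deriv]
    have : r ≠ 0 := hr.1.ne'
    have h2 : -r⁻¹ / Real.log (Real.exp 1 / r) = -(r ^ (Module.finrank ℝ E2 - 1) • ((r ^ 2)⁻¹ * (Real.log (Real.exp 1 / r))⁻¹)) := by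
      simp
      field_simp
    rw [h2, norm_neg, one_mul]


/-! ### integration by parts away from the origin -/

lemma cont_mul {g ψ : E2 → ℝ} (hg : ContinuousOn g U) (hψ : Continuous ψ)
    (hs : tsupport ψ ⊆ U) : Continuous fun x => g x * ψ x := by
  refine continuous_of_tsupport fun x hx => ?_
  have hx' : x ∈ U := hs (tsupport_mul_subset_right (f := g) (g := ψ) hx)
  exact (hg.continuousAt (isOpen_U.mem_nhds hx')).mul hψ.continuousAt

lemma int_mul {g ψ : E2 → ℝ} (hg : ContinuousOn g U) (hψ : Continuous ψ)
    (hc : HasCompactSupport ψ) (hs : tsupport ψ ⊆ U) :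
    Integrable (fun x => g x * ψ x) volume :=
  (cont_mul hg hψ hs).integrable_of_hasCompactSupport (hc.mul_left (f := g))

lemma tsupport_D (i : Fin 2) (φ : E2 → ℝ) : tsupport (D i φ) ⊆ tsupport φ :=
  tsupport_fderiv_apply_subset ℝ (e i)

lemma hcs_D {φ : E2 → ℝ} (hc : HasCompactSupport φ) (i : Fin 2) : HasCompactSupport (D i φ) :=
  hc.fderiv_apply ℝ (e i)

lemma cont_D {φ : E2 → ℝ} (hφ : ContDiff ℝ 1 φ) (i : Fin 2) : Continuous (D i φ) :=
  (hφ.continuous_fderiv (by simp)).clm_apply continuous_const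

lemma contDiff_D {φ : E2 → ℝ} (hφ : ContDiff ℝ (⊤ : ℕ∞) φ) (i : Fin 2) :
    ContDiff ℝ (⊤ : ℕ∞) (D i φ) :=
  (hφ.fderiv_right (m := (⊤ : ℕ∞)) (by simp)).clm_apply contDiff_const

lemma contOn_D {g : E2 → ℝ} (hg : ContDiffOn ℝ 1 g U) (i : Fin 2) : ContinuousOn (D i g) U :=
  (hg.continuousOn_fderiv_of_isOpen isOpen_U le_rfl).clm_apply continuousOn_const

lemma set_eq {g ψ : E2 → ℝ} {S : Set E2} (hs : tsupport ψ ⊆ S) :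
    ∫ x in S, g x * ψ x = ∫ x, g x * ψ x := by
  refine setIntegral_eq_integral_of_forall_compl_eq_zero fun x hx => ?_
  rw [image_eq_zero_of_notMem_tsupport (fun h => hx (hs h)), mul_zero]

lemma ibp {φ g : E2 → ℝ} (hφ : ContDiff ℝ 1 φ) (hc : HasCompactSupport φ)
    (hs : tsupport φ ⊆ U) (hg : ContDiffOn ℝ 1 g U) (i : Fin 2) :
    ∫ x, g x * D i φ x = -∫ x, D i g x * φ x := by
  have h1 := int_mul (contOn_D hg i) hφ.continuous hc hs
  have h2 := int_mul hg.continuousOn (cont_D hφ i) (hcs_D hc i) ((tsupport_D i φ).trans hs)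
  have h3 := int_mul hg.continuousOn hφ.continuous hc hs
  have := integral_bilinear_hasLineDerivAt_right_eq_neg_left_of_integrable
    (μ := (volume : Measure E2)) (f := g) (f' := D i g) (g := φ) (g' := D i φ) (v := e i)
    (B := ContinuousLinearMap.mul ℝ ℝ) (by simpa using h1) (by simpa using h2)
    (by simpa using h3) ?_ ?_
  · simpa using this
  · intro x hx
    have hd : DifferentiableAt ℝ g x :=
      (hg.contDiffAt (isOpen_U.mem_nhds (hs hx))).differentiableAt (by simp)
    exact hd.hasFDerivAt.hasLineDerivAt (e i)
  · intro x _
    exact (hφ.differentiable (by simp) x).hasFDerivAt.hasLineDerivAt (e i)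

/-! ### cutoffs -/

noncomputable def cut (k : ℝ) (x : E2) : ℝ :=
  if x = 0 then 0 else 1 - Real.smoothTransition (L x / k - 1)

lemma tendsto_L : Tendsto L (𝓝[≠] 0) atTop :=
  tendsto_L0.comp tendsto_norm_nhdsNE_zero

lemma cut_zero_near {k : ℝ} (hk : 0 < k) : cut k =ᶠ[𝓝 0] 0 := by
  have h := tendsto_L.eventually_ge_atTop (2 * k)
  rw [eventually_nhdsWithin_iff] at h
  filter_upwards [h] with x hx
  by_cases h0 : x = 0
  · simp [cut, h0]
  · have := hx h0
    simp only [cut, h0, if_false, Pi.zero_apply]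
    rw [Real.smoothTransition.one_of_one_le]; · simp
    have : 2 ≤ L x / k := by rw [le_div_iff₀ hk]; exact this
    linarith

lemma cut_eq_near {x : E2} (hx : x ≠ 0) (k : ℝ) :
    cut k =ᶠ[𝓝 x] fun y => 1 - Real.smoothTransition (L y / k - 1) := by
  filter_upwards [isOpen_ne.mem_nhds hx] with y hy
  have : y ≠ 0 := hy
  simp [cut, this]

lemma contDiff_cut {k : ℝ} (hk : 0 < k) : ContDiff ℝ 1 (cut k) := by
  rw [contDiff_iff_contDiffAt]
  intro x
  by_cases hx : x = 0
  · subst hx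
    exact (contDiffAt_const (c := (0:ℝ))).congr_of_eventuallyEq (cut_zero_near hk)
  · refine ContDiffAt.congr_of_eventuallyEq ?_ (cut_eq_near hx k)
    have h1 : ContDiffAt ℝ 1 (fun y => L y / k - 1) x :=
      ((contDiffAt_L hx).div_const k).sub contDiffAt_const
    have h2 : ContDiff ℝ 1 Real.smoothTransition := Real.smoothTransition.contDiff (n := 1)
    exact contDiffAt_const.sub (h2.contDiffAt.comp x h1)

lemma abs_cut_le (k : ℝ) (x : E2) : |cut k x| ≤ 1 := by
  unfold cut
  split_ifs
  · simp
  · rw [abs_le]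
    constructor <;> linarith [Real.smoothTransition.nonneg (L x / k - 1),
      Real.smoothTransition.le_one (L x / k - 1)]

lemma D_cut {x : E2} (hx : x ≠ 0) (k : ℝ) (i : Fin 2) :
    D i (cut k) x = deriv Real.smoothTransition (L x / k - 1) * (x i * (‖x‖ ^ 2)⁻¹ / k) := by
  have h2 : ContDiff ℝ 1 Real.smoothTransition := Real.smoothTransition.contDiff (n := 1)
  have h3 := (h2.differentiable (by simp) (L x / k - 1)).hasDerivAt
  have h1 : HasFDerivAt (fun y => L y / k - 1) (k⁻¹ • (-(‖x‖ ^ 2)⁻¹ • innerSL ℝ x)) x := by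
    simpa [div_eq_inv_mul] using ((hasFDerivAt_L hx).const_mul k⁻¹).sub_const 1
  have h4 := (h3.comp_hasFDerivAt x h1).const_sub 1
  have h5 : HasFDerivAt (cut k) _ x := h4.congr_of_eventuallyEq (cut_eq_near hx k)
  rw [D, h5.fderiv]
  simp [inner_e]
  left
  ring

lemma deriv_st_zero_of_neg {t : ℝ} (ht : t < 0) : deriv Real.smoothTransition t = 0 := by
  have : Real.smoothTransition =ᶠ[𝓝 t] fun _ => 0 := by
    filter_upwards [gt_mem_nhds ht] with s hs using Real.smoothTransition.zero_of_nonpos hs.le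
  rw [this.deriv_eq]; simp

lemma deriv_st_zero_of_gt {t : ℝ} (ht : 1 < t) : deriv Real.smoothTransition t = 0 := by
  have : Real.smoothTransition =ᶠ[𝓝 t] fun _ => 1 := by
    filter_upwards [lt_mem_nhds ht] with s hs using Real.smoothTransition.one_of_one_le hs.le
  rw [this.deriv_eq]; simp

lemma exists_C : ∃ C : ℝ, 0 ≤ C ∧ ∀ t : ℝ, |deriv Real.smoothTransition (t - 1) * t| ≤ C := by
  have h2 : ContDiff ℝ 1 Real.smoothTransition := Real.smoothTransition.contDiff (n := 1)
  have hc : Continuous fun t : ℝ => deriv Real.smoothTransition (t - 1) * t :=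
    ((h2.continuous_deriv (by simp)).comp (continuous_id.sub continuous_const)).mul continuous_id
  obtain ⟨C, hC⟩ := (isCompact_Icc (a := (1:ℝ)) (b := 2)).exists_bound_of_continuousOn
    hc.continuousOn
  refine ⟨max C 0, le_max_right _ _, fun t => ?_⟩
  by_cases h : t ∈ Icc (1:ℝ) 2
  · exact (hC t h).trans (le_max_left _ _)
  · have : deriv Real.smoothTransition (t - 1) = 0 := by
      rw [mem_Icc, not_and_or, not_le, not_le] at h
      rcases h with h | h
      · exact deriv_st_zero_of_neg (by linarith)
      · exact deriv_st_zero_of_gt (by linarith)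
    simp [this]

lemma abs_D_cut_le {C : ℝ} (hC : ∀ t : ℝ, |deriv Real.smoothTransition (t - 1) * t| ≤ C)
    {x : E2} (hx : x ∈ U) {k : ℝ} (hk : 0 < k) (i : Fin 2) :
    |D i (cut k) x| ≤ C * (‖x‖⁻¹ * (L x)⁻¹) := by
  have hL : 0 < L x := by linarith [one_lt_L hx]
  have h : D i (cut k) x =
      -((deriv Real.smoothTransition (L x / k - 1) * (L x / k)) * G i x) := by
    rw [D_cut (U_ne hx), G]
    field_simp
  rw [h, abs_neg, abs_mul]
  have h0 := hC (L x / k)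
  have := abs_nonneg (deriv Real.smoothTransition (L x / k - 1) * (L x / k))
  exact mul_le_mul h0 (abs_G_le hx i) (abs_nonneg _) (by linarith)

lemma ev_div_lt (a : ℝ) : ∀ᶠ n : ℕ in atTop, a / ((n : ℝ) + 1) < 1 := by
  have : Tendsto (fun n : ℕ => a / ((n : ℝ) + 1)) atTop (𝓝 0) :=
    tendsto_const_nhds.div_atTop (tendsto_atTop_add_const_right _ _ tendsto_natCast_atTop_atTop)
  exact this.eventually (gt_mem_nhds one_pos)

lemma ev_cut {x : E2} (hx : x ≠ 0) : ∀ᶠ n : ℕ in atTop, cut ((n : ℝ) + 1) x = 1 := by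
  filter_upwards [ev_div_lt (L x)] with n hn
  simp only [cut, hx, if_false]
  rw [Real.smoothTransition.zero_of_nonpos (by linarith)]; simp

lemma ev_D_cut {x : E2} (hx : x ≠ 0) (i : Fin 2) :
    ∀ᶠ n : ℕ in atTop, D i (cut ((n : ℝ) + 1)) x = 0 := by
  filter_upwards [ev_div_lt (L x)] with n hn
  rw [D_cut hx, deriv_st_zero_of_neg (by linarith), zero_mul]

lemma D_mul {f g : E2 → ℝ} (hf : ContDiff ℝ 1 f) (hg : ContDiff ℝ 1 g) (i : Fin 2) (x : E2) :
    D i (fun y => f y * g y) x = f x * D i g x + g x * D i f x := by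
  have := ((hf.differentiable (by simp) x).hasFDerivAt.mul
    (hg.differentiable (by simp) x).hasFDerivAt).fderiv
  rw [D]
  erw [this]
  simp [D]

lemma ibpV {φ : E2 → ℝ} (hφ : ContDiff ℝ 1 φ) (hc : HasCompactSupport φ)
    (hs : tsupport φ ⊆ ball 0 1) (F : Fin 2 → E2 → ℝ) (d h : E2 → ℝ)
    (hF : ∀ i, ContDiffOn ℝ 1 (F i) U)
    (hd : ∀ x ∈ U, ∑ i, D i (F i) x = d x) (hdi : IntegrableOn d U)
    (hFb : ∀ i, ∀ x ∈ U, |F i x| ≤ ‖x‖⁻¹) (hh : IntegrableOn h U)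
    (hFh : ∀ i, ∀ x ∈ U, |F i x| * (‖x‖⁻¹ * (L x)⁻¹) ≤ h x) :
    ∫ x in U, ∑ i, F i x * D i φ x = -∫ x in U, d x * φ x := by
  have hUm : MeasurableSet U := isOpen_U.measurableSet
  obtain ⟨C, hC0, hC⟩ := exists_C
  have hM : ∃ M : ℝ, 0 ≤ M ∧ (∀ x, |φ x| ≤ M) ∧ ∀ i x, |D i φ x| ≤ M := by
    obtain ⟨M, hM⟩ := hc.exists_bound_of_continuous hφ.continuous
    obtain ⟨M0, hM0⟩ := (hcs_D hc 0).exists_bound_of_continuous (cont_D hφ 0)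
    obtain ⟨M1, hM1⟩ := (hcs_D hc 1).exists_bound_of_continuous (cont_D hφ 1)
    refine ⟨max M (max M0 M1), ?_, ?_, ?_⟩
    · exact ((norm_nonneg _).trans (hM 0)).trans (le_max_left _ _)
    · exact fun x => (hM x).trans (le_max_left _ _)
    · intro i x
      fin_cases i
      · exact (hM0 x).trans ((le_max_left _ _).trans (le_max_right _ _))
      · exact (hM1 x).trans ((le_max_right _ _).trans (le_max_right _ _))
  obtain ⟨M, hM0, hMφ, hMD⟩ := hM
  have hk : ∀ n : ℕ, (0:ℝ) < (n : ℝ) + 1 := fun n => by positivity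
  let ψ : ℕ → E2 → ℝ := fun n x => φ x * cut ((n:ℝ) + 1) x
  have hψ : ∀ n, ContDiff ℝ 1 (ψ n) := fun n => hφ.mul (contDiff_cut (hk n))
  have hψc : ∀ n, HasCompactSupport (ψ n) := fun n => hc.mul_right
  have hψs : ∀ n, tsupport (ψ n) ⊆ U := fun n x hx => by
    refine ⟨hs (tsupport_mul_subset_left hx), ?_⟩
    rintro rfl
    have := tsupport_mul_subset_right (f := φ) (g := cut ((n:ℝ) + 1)) hx
    exact absurd (cut_zero_near (hk n)) (by
      rw [← notMem_tsupport_iff_eventuallyEq]; exact not_not.2 this)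
  have hDψ : ∀ n i x, D i (ψ n) x =
      φ x * D i (cut ((n:ℝ)+1)) x + cut ((n:ℝ)+1) x * D i φ x := fun n i x =>
    D_mul hφ (contDiff_cut (hk n)) i x
  have hint : ∀ n i, IntegrableOn (fun x => F i x * D i (ψ n) x) U := fun n i =>
    (int_mul (hF i).continuousOn (cont_D (hψ n) i) (hcs_D (hψc n) i)
      ((tsupport_D i _).trans (hψs n))).integrableOn
  have hint2 : ∀ n i, IntegrableOn (fun x => D i (F i) x * ψ n x) U := fun n i =>
    (int_mul (contOn_D (hF i) i) (hψ n).continuous (hψc n) (hψs n)).integrableOn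
  have hid : ∀ n, ∫ x in U, ∑ i, F i x * D i (ψ n) x = -∫ x in U, d x * ψ n x := by
    intro n
    rw [integral_finsetSum _ fun i _ => hint n i]
    have : ∫ x in U, d x * ψ n x = ∫ x in U, ∑ i, D i (F i) x * ψ n x := by
      refine setIntegral_congr_fun hUm fun x hx => ?_
      rw [← hd x hx, Finset.sum_mul]
    rw [this, integral_finsetSum _ fun i _ => hint2 n i, ← Finset.sum_neg_distrib]
    refine Finset.sum_congr rfl fun i _ => ?_
    rw [set_eq ((tsupport_D i _).trans (hψs n)), set_eq (hψs n)]
    exact ibp (hψ n) (hψc n) (hψs n) (hF i) i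
  have l1 : Tendsto (fun n => ∫ x in U, d x * ψ n x) atTop (𝓝 (∫ x in U, d x * φ x)) := by
    refine tendsto_integral_of_dominated_convergence (fun x => |d x| * M) ?_ ?_ ?_ ?_
    · exact fun n => hdi.aestronglyMeasurable.mul (hψ n).continuous.aestronglyMeasurable
    · exact hdi.abs.mul_const M
    · intro n
      refine Eventually.of_forall fun x => ?_
      rw [Real.norm_eq_abs, abs_mul, abs_mul]
      refine mul_le_mul_of_nonneg_left ?_ (abs_nonneg _)
      calc |φ x| * |cut ((n:ℝ)+1) x| ≤ M * 1 :=
            mul_le_mul (hMφ x) (abs_cut_le _ x) (abs_nonneg _) hM0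
        _ = M := mul_one M
    · refine (ae_restrict_iff' hUm).2 (Eventually.of_forall fun x hx => ?_)
      refine tendsto_const_nhds.congr' ?_
      filter_upwards [ev_cut (U_ne hx)] with n hn
      simp [ψ, hn]
  have l2 : Tendsto (fun n => ∫ x in U, ∑ i, F i x * D i (ψ n) x) atTop
      (𝓝 (∫ x in U, ∑ i, F i x * D i φ x)) := by
    refine tendsto_integral_of_dominated_convergence
      (fun x => ∑ _i : Fin 2, (M * C * h x + ‖x‖⁻¹ * M)) ?_ ?_ ?_ ?_
    · exact fun n => (integrable_finsetSum _ fun i _ => hint n i).aestronglyMeasurable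
    · refine integrable_finsetSum _ fun i _ => ?_
      have h1 : IntegrableOn (fun x : E2 => ‖x‖⁻¹) U := int_inv.mono_set sdiff_subset
      exact (Integrable.const_mul hh (M * C)).add (h1.mul_const M)
    · intro n
      refine (ae_restrict_iff' hUm).2 (Eventually.of_forall fun x hx => ?_)
      refine (norm_sum_le _ _).trans (Finset.sum_le_sum fun i _ => ?_)
      rw [hDψ, Real.norm_eq_abs, mul_add]
      refine (abs_add_le _ _).trans (add_le_add ?_ ?_)
      · rw [abs_mul, abs_mul]
        have h1 := abs_D_cut_le hC hx (hk n) i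
        have h2 := hFh i x hx
        calc |F i x| * (|φ x| * |D i (cut ((n:ℝ)+1)) x|)
            ≤ |F i x| * (M * (C * (‖x‖⁻¹ * (L x)⁻¹))) := by
              refine mul_le_mul_of_nonneg_left ?_ (abs_nonneg _)
              exact mul_le_mul (hMφ x) h1 (abs_nonneg _) hM0
          _ = M * C * (|F i x| * (‖x‖⁻¹ * (L x)⁻¹)) := by ring
          _ ≤ M * C * h x := mul_le_mul_of_nonneg_left h2 (mul_nonneg hM0 hC0)
      · rw [abs_mul, abs_mul]
        refine mul_le_mul (hFb i x hx) ?_ (by positivity) (by positivity)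
        calc |cut ((n:ℝ)+1) x| * |D i φ x| ≤ 1 * M :=
              mul_le_mul (abs_cut_le _ x) (hMD i x) (abs_nonneg _) zero_le_one
          _ = M := one_mul M
    · refine (ae_restrict_iff' hUm).2 (Eventually.of_forall fun x hx => ?_)
      refine tendsto_const_nhds.congr' ?_
      filter_upwards [ev_cut (U_ne hx), ev_D_cut (U_ne hx) 0, ev_D_cut (U_ne hx) 1] with n hn h0 h1
      simp [hDψ, hn, h0, h1]
  refine tendsto_nhds_unique l2 ?_
  simp only [hid]
  exact l1.neg

lemma int_inv_U : IntegrableOn (fun x : E2 => ‖x‖⁻¹) U := int_inv.mono_set sdiff_subset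

lemma meas_U : MeasurableSet U := isOpen_U.measurableSet

lemma int_G (i : Fin 2) : IntegrableOn (G i) U := by
  refine Integrable.mono' int_inv_U
    ((contDiffOn_G (n := 1) i).continuousOn.aestronglyMeasurable meas_U) ?_
  refine (ae_restrict_iff' meas_U).2 (Eventually.of_forall fun x hx => ?_)
  refine (abs_G_le hx i).trans ?_
  have := U_pos hx
  exact mul_le_of_le_one_right (by positivity) (inv_le_one_of_one_le₀ (one_lt_L hx).le)

/-- First step: `G` is the distributional gradient of `u`. -/
lemma step1 {φ : E2 → ℝ} (hφ : ContDiff ℝ 1 φ) (hc : HasCompactSupport φ)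
    (hs : tsupport φ ⊆ ball 0 1) (i : Fin 2) :
    ∫ x in U, u x * D i φ x = -∫ x in U, G i x * φ x := by
  have hD0 : ∀ (j : Fin 2) (x : E2), D j (fun _ => (0:ℝ)) x = 0 := fun j x => by simp [D]
  have := ibpV hφ hc hs (fun j => if j = i then u else fun _ => 0) (G i) (fun x => ‖x‖⁻¹)
    ?_ ?_ (int_G i) ?_ int_inv_U ?_
  · rw [← this]
    refine setIntegral_congr_fun meas_U fun x hx => ?_
    fin_cases i <;> simp
  · intro j
    by_cases h : j = i
    · simpa [h] using contDiffOn_u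
    · simpa [h] using contDiffOn_const
  · intro x hx
    rw [← D_u hx i]
    fin_cases i <;> simp [hD0]
  · intro j x hx
    by_cases h : j = i
    · simpa [h] using abs_u_le hx
    · simp [h]
  · intro j x hx
    have hL : 0 < L x := by linarith [one_lt_L hx]
    have hr := U_pos hx
    by_cases h : j = i
    · simp only [h, if_true]
      calc |u x| * (‖x‖⁻¹ * (L x)⁻¹) ≤ L x * (‖x‖⁻¹ * (L x)⁻¹) :=
            mul_le_mul_of_nonneg_right (abs_u_le_L hx) (by positivity)
        _ = ‖x‖⁻¹ := by field_simp
    · simp [h]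

lemma int_sq_U : IntegrableOn (fun x : E2 => (‖x‖ ^ 2 * L x ^ 2)⁻¹) U :=
  int_sq.mono_set sdiff_subset

/-- Second step: the divergence of `G`. -/
lemma step2 {φ : E2 → ℝ} (hφ : ContDiff ℝ 1 φ) (hc : HasCompactSupport φ)
    (hs : tsupport φ ⊆ ball 0 1) :
    ∫ x in U, ∑ i, G i x * D i φ x = -∫ x in U, -(‖x‖ ^ 2 * L x ^ 2)⁻¹ * φ x := by
  refine ibpV hφ hc hs G (fun x => -(‖x‖ ^ 2 * L x ^ 2)⁻¹) (fun x => (‖x‖ ^ 2 * L x ^ 2)⁻¹)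
    contDiffOn_G ?_ int_sq_U.neg ?_ int_sq_U ?_
  · intro x hx
    rw [← sum_K hx]
    exact Finset.sum_congr rfl fun i _ => D_G hx i i
  · intro i x hx
    refine (abs_G_le hx i).trans ?_
    have := U_pos hx
    exact mul_le_of_le_one_right (by positivity) (inv_le_one_of_one_le₀ (one_lt_L hx).le)
  · intro i x hx
    have hL : 0 < L x := by linarith [one_lt_L hx]
    have hr := U_pos hx
    calc |G i x| * (‖x‖⁻¹ * (L x)⁻¹) ≤ (‖x‖⁻¹ * (L x)⁻¹) * (‖x‖⁻¹ * (L x)⁻¹) :=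
          mul_le_mul_of_nonneg_right (abs_G_le hx i) (by positivity)
      _ = (‖x‖ ^ 2 * L x ^ 2)⁻¹ := by field_simp

lemma int_u : IntegrableOn u U := by
  refine Integrable.mono' int_inv_U
    ((contDiffOn_u (n := 1)).continuousOn.aestronglyMeasurable meas_U) ?_
  exact (ae_restrict_iff' meas_U).2 (Eventually.of_forall fun x hx => abs_u_le hx)

lemma int_mul_bdd {g ψ : E2 → ℝ} (hg : IntegrableOn g U) (hψ : Continuous ψ)
    (hc : HasCompactSupport ψ) : IntegrableOn (fun x => g x * ψ x) U := by
  obtain ⟨M, hM⟩ := hc.exists_bound_of_continuous hψ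
  exact Integrable.mul_bdd hg hψ.aestronglyMeasurable (Eventually.of_forall hM)

lemma laplacian {φ : E2 → ℝ} (hφ : ContDiff ℝ (⊤ : ℕ∞) φ) (hc : HasCompactSupport φ)
    (hs : tsupport φ ⊆ ball 0 1) :
    ∫ x in U, u x * ∑ i, D i (D i φ) x = ∫ x in U, -(‖x‖ ^ 2 * L x ^ 2)⁻¹ * φ x := by
  have h1 : ∀ i, ContDiff ℝ 1 (D i φ) := fun i => (contDiff_D hφ i).of_le (by simp)
  have hφ1 : ContDiff ℝ 1 φ := hφ.of_le (by simp)
  have h2 := step2 hφ1 hc hs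
  rw [integral_finsetSum _ fun i _ => int_mul_bdd (int_G i) (cont_D hφ1 i) (hcs_D hc i)] at h2
  simp only [Finset.mul_sum]
  rw [integral_finsetSum _ fun i _ => int_mul_bdd int_u (cont_D (h1 i) i) (hcs_D (hcs_D hc i) i)]
  simp only [fun i => step1 (h1 i) (hcs_D hc i) ((tsupport_D i φ).trans hs) i]
  rw [Finset.sum_neg_distrib, h2, neg_neg]

/-- second derivatives away from the origin -/
lemma hess {φ : E2 → ℝ} (hφ : ContDiff ℝ (⊤ : ℕ∞) φ) (hc : HasCompactSupport φ)
    (hs : tsupport φ ⊆ U) (i j : Fin 2) :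
    ∫ x, u x * D j (D i φ) x = ∫ x, K i j x * φ x := by
  have h1 : ContDiff ℝ 1 (D i φ) := (contDiff_D hφ i).of_le (by simp)
  have hφ1 : ContDiff ℝ 1 φ := hφ.of_le (by simp)
  have hs1 := (tsupport_D i φ).trans hs
  rw [ibp h1 (hcs_D hc i) hs1 contDiffOn_u j]
  have e1 : ∫ x, D j u x * D i φ x = ∫ x, G j x * D i φ x := by
    rw [← set_eq hs1, ← set_eq hs1]
    exact setIntegral_congr_fun meas_U fun x hx => by simp only [D_u hx]
  rw [e1, ibp hφ1 hc hs (contDiffOn_G j) i, neg_neg, ← set_eq hs, ← set_eq hs]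
  exact setIntegral_congr_fun meas_U fun x hx => by simp only [D_G hx]

lemma not_int_K : ¬ ∀ i j, IntegrableOn (K i j) U := by
  intro hK
  apply not_int
  rw [IntegrableOn, restrict_U]
  have hb : IntegrableOn (fun x => |K 0 0 x| + |K 1 1 x| + 2 * |K 0 1 x|) U :=
    ((hK 0 0).abs.add (hK 1 1).abs).add ((hK 0 1).abs.const_mul 2)
  have hcont : ContinuousOn (fun x : E2 => (‖x‖ ^ 2)⁻¹ * (L x)⁻¹) U := fun x hx => by
    have h0 : ‖x‖ ^ 2 ≠ 0 := pow_ne_zero 2 (U_pos hx).ne'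
    have hL : L x ≠ 0 := by linarith [one_lt_L hx]
    exact (((continuous_norm.pow 2).continuousAt.inv₀ h0).mul
      ((hasFDerivAt_L (U_ne hx)).continuousAt.inv₀ hL)).continuousWithinAt
  refine Integrable.mono' hb (hcont.aestronglyMeasurable meas_U) ?_
  refine (ae_restrict_iff' meas_U).2 (Eventually.of_forall fun x hx => ?_)
  have hL := one_lt_L hx
  have hr := U_pos hx
  have hL0 : 0 < L x := by linarith
  rw [Real.norm_eq_abs, abs_of_pos (by positivity)]
  set m := (‖x‖ ^ 2)⁻¹ with hm
  have hm0 : 0 < m := by positivity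
  set l := (L x)⁻¹ with hl
  have hl0 : 0 < l := by positivity
  have hl1 : l ≤ 1 := inv_le_one_of_one_le₀ hL.le
  have hmn : m * (x 0 ^ 2 + x 1 ^ 2) = 1 := by
    rw [← norm_sq_eq, hm]; field_simp
  have hq : l ≤ 2 * l - l ^ 2 := by nlinarith
  set q := 2 * l - l ^ 2 with hqdef
  have k1 : K 0 0 x - K 1 1 x = (x 0 ^ 2 - x 1 ^ 2) * m ^ 2 * q := by
    simp only [K, ← hm, ← hl, ← hqdef, if_true]; ring
  have k2 : K 0 1 x = x 0 * x 1 * m ^ 2 * q := by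
    simp only [K, ← hm, ← hl, ← hqdef, zero_ne_one, if_false]; ring
  have hsq : (K 0 0 x - K 1 1 x) ^ 2 + (2 * K 0 1 x) ^ 2 = (m * q) ^ 2 := by
    rw [k1, k2]
    have : ((x 0 ^ 2 - x 1 ^ 2) * m ^ 2 * q) ^ 2 + (2 * (x 0 * x 1 * m ^ 2 * q)) ^ 2
      = (m * q) ^ 2 * (m * (x 0 ^ 2 + x 1 ^ 2)) ^ 2 := by ring
    rw [this, hmn]; ring
  have hle : m * q ≤ |K 0 0 x - K 1 1 x| + |2 * K 0 1 x| := by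
    refine abs_le_of_sq_le_sq' ?_ (by positivity) |>.2
    rw [← hsq, ← sq_abs (K 0 0 x - K 1 1 x), ← sq_abs (2 * K 0 1 x)]
    nlinarith [mul_nonneg (abs_nonneg (K 0 0 x - K 1 1 x)) (abs_nonneg (2 * K 0 1 x))]
  have h3 : |K 0 0 x - K 1 1 x| ≤ |K 0 0 x| + |K 1 1 x| := abs_sub _ _
  have h4 : |2 * K 0 1 x| = 2 * |K 0 1 x| := by rw [abs_mul]; norm_num
  calc m * l ≤ m * q := mul_le_mul_of_nonneg_left hq hm0.le
    _ ≤ _ := by linarith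

end LogLog

/-- The Grafakos–Maldonado counterexample: for `u(x) = log log(e/|x|)` on the unit disk of
`ℝ²`, the distributional Laplacian is `−1/(|x|² log²(e/|x|)) ∈ L¹(B₁)`, while the
distributional Hessian `D²u` is not (given by) an `L¹` matrix-valued function on `B₁`. -/
theorem loglog_laplacian_L1_hessian_not_L1 :
    IntegrableOn (fun x : EuclideanSpace ℝ (Fin 2) =>
        -(‖x‖ ^ 2 * (Real.log (Real.exp 1 / ‖x‖)) ^ 2)⁻¹) (ball 0 1) volume ∧
    (∀ φ : EuclideanSpace ℝ (Fin 2) → ℝ, ContDiff ℝ (⊤ : ℕ∞) φ → HasCompactSupport φ →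
      tsupport φ ⊆ ball (0 : EuclideanSpace ℝ (Fin 2)) 1 →
      (∫ x in ball (0 : EuclideanSpace ℝ (Fin 2)) 1,
          Real.log (Real.log (Real.exp 1 / ‖x‖)) *
            ∑ i : Fin 2, fderiv ℝ (fun y => fderiv ℝ φ y (EuclideanSpace.single i 1)) x
              (EuclideanSpace.single i 1))
        = ∫ x in ball (0 : EuclideanSpace ℝ (Fin 2)) 1,
            (-(‖x‖ ^ 2 * (Real.log (Real.exp 1 / ‖x‖)) ^ 2)⁻¹) * φ x) ∧
    ¬ ∃ H : EuclideanSpace ℝ (Fin 2) → Fin 2 → Fin 2 → ℝ,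
        (∀ i j, IntegrableOn (fun x => H x i j) (ball 0 1) volume) ∧
        ∀ φ : EuclideanSpace ℝ (Fin 2) → ℝ, ContDiff ℝ (⊤ : ℕ∞) φ → HasCompactSupport φ →
          tsupport φ ⊆ ball (0 : EuclideanSpace ℝ (Fin 2)) 1 → ∀ i j : Fin 2,
          (∫ x in ball (0 : EuclideanSpace ℝ (Fin 2)) 1,
              Real.log (Real.log (Real.exp 1 / ‖x‖)) *
                fderiv ℝ (fun y => fderiv ℝ φ y (EuclideanSpace.single i 1)) x
                  (EuclideanSpace.single j 1))
            = ∫ x in ball (0 : EuclideanSpace ℝ (Fin 2)) 1, H x i j * φ x := by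
  refine ⟨LogLog.int_sq.neg, ?_, ?_⟩
  · intro φ hφ hc hs
    rw [LogLog.restrict_U]
    exact LogLog.laplacian hφ hc hs
  · rintro ⟨H, hH, hφ⟩
    apply LogLog.not_int_K
    intro i j
    have hHU : IntegrableOn (fun x => H x i j) LogLog.U := (hH i j).mono_set Set.sdiff_subset
    have key : ∀ᵐ x ∂(volume : Measure LogLog.E2), x ∈ LogLog.U →
        (H x i j - LogLog.K i j x) = 0 := by
      refine LogLog.isOpen_U.ae_eq_zero_of_integral_contDiff_smul_eq_zero ?_ ?_
      · exact hHU.locallyIntegrableOn.sub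
          ((LogLog.contOn_K i j).locallyIntegrableOn LogLog.meas_U)
      · intro φ h1 h2 h3
        have h4 : tsupport φ ⊆ ball (0 : LogLog.E2) 1 := h3.trans Set.sdiff_subset
        have h5 := hφ φ h1 h2 h4 i j
        have h6 : ∫ x in ball (0 : LogLog.E2) 1, LogLog.u x * LogLog.D j (LogLog.D i φ) x
            = ∫ x in ball (0 : LogLog.E2) 1, H x i j * φ x := h5
        rw [LogLog.set_eq ((LogLog.tsupport_D j _).trans ((LogLog.tsupport_D i φ).trans h4)),
          LogLog.hess h1 h2 h3, ← LogLog.set_eq h3, LogLog.restrict_U] at h6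
        have h7 : ∫ x, φ x • (H x i j - LogLog.K i j x)
            = ∫ x in LogLog.U, (H x i j - LogLog.K i j x) * φ x := by
          rw [LogLog.set_eq h3]
          simp only [smul_eq_mul, mul_comm]
        rw [h7]
        simp only [sub_mul]
        rw [integral_sub (LogLog.int_mul_bdd hHU h1.continuous h2)
          (LogLog.int_mul (LogLog.contOn_K i j) h1.continuous h2 h3).integrableOn, h6, sub_self]
    refine hHU.congr ?_
    refine (ae_restrict_iff' LogLog.meas_U).2 ?_
    filter_upwards [key] with x hx hxU
    linarith [hx hxU]
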